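/- Let f ≥ 0 and n be integers with n ≤ 2f + 3, and let λ be a bipartition of n. Then, for the counts attached to the f-shifted path sequence of λ, one has b_l + b_m + b_r = f + a_l + a_m + a_r. -/

import Mathlib

/-- A partition: a non-increasing sequence of non-negative integers with finite sum.
Here `part i` is the `(i+1)`-st part `λ_{i+1}`. -/
structure PartitionSeq : Type where
  part : ℕ → ℕ
  antitone' : ∀ {i j : ℕ}, i ≤ j → part j ≤ part i
  eventually_zero : ∃ N : ℕ, ∀ i : ℕ, N ≤ i → part i = 0

/-- The size `|λ| = Σ_i λ_i` of a partition. -/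
noncomputable def PartitionSeq.size (μ : PartitionSeq) : ℕ := ∑ᶠ i : ℕ, μ.part i

open scoped Classical in
/-- The path sequence (Maya diagram) of a partition: `p_λ(i) = 0` if
`i = λ_j - j + 1` for some `j ≥ 1` (i.e. `i = part j - j` for some `j : ℕ` in the
0-indexed convention used here), and `p_λ(i) = 1` otherwise. -/
noncomputable def PartitionSeq.path (μ : PartitionSeq) (i : ℤ) : ℕ :=
  if ∃ j : ℕ, i = (μ.part j : ℤ) - (j : ℤ) then 0 else 1

section PathCounts

variable (μ₁ μ₂ : PartitionSeq) (f : ℕ)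

/-- Predicate: position `i` of the `f`-shifted path sequence of the bipartition
`(μ₁, μ₂)` carries the pair `A = (0,1)`. -/
def pairA (i : ℤ) : Prop := μ₁.path i = 0 ∧ μ₂.path (i - f) = 1

/-- Pair `B = (1,0)` at position `i`. -/
def pairB (i : ℤ) : Prop := μ₁.path i = 1 ∧ μ₂.path (i - f) = 0

/-- Pair `C = (0,0)` at position `i`. -/
def pairC (i : ℤ) : Prop := μ₁.path i = 0 ∧ μ₂.path (i - f) = 0

/-- Pair `D = (1,1)` at position `i`. -/
def pairD (i : ℤ) : Prop := μ₁.path i = 1 ∧ μ₂.path (i - f) = 1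

/-- The number of positions `i ≤ 0` (the left region) where `P` holds. -/
noncomputable def countL (P : ℤ → Prop) : ℕ := Set.ncard {i : ℤ | i ≤ 0 ∧ P i}

/-- The number of positions `1 ≤ i ≤ f` (the middle region) where `P` holds. -/
noncomputable def countM (P : ℤ → Prop) : ℕ :=
  Set.ncard {i : ℤ | 1 ≤ i ∧ i ≤ (f : ℤ) ∧ P i}

/-- The number of positions `i > f` (the right region) where `P` holds. -/
noncomputable def countR (P : ℤ → Prop) : ℕ := Set.ncard {i : ℤ | (f : ℤ) < i ∧ P i}

end PathCounts

namespace PartitionSeq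

/-- The positions of the beads attached to the first `N` parts. -/
def beads (μ : PartitionSeq) (N : ℕ) : Finset ℤ :=
  (Finset.range N).image fun j : ℕ => (μ.part j : ℤ) - (j : ℤ)

theorem path_eq_zero_iff (μ : PartitionSeq) (i : ℤ) :
    μ.path i = 0 ↔ ∃ j : ℕ, i = (μ.part j : ℤ) - (j : ℤ) := by
  unfold path; split_ifs <;> simp_all

theorem path_eq_one_iff (μ : PartitionSeq) (i : ℤ) : μ.path i = 1 ↔ ¬ μ.path i = 0 := by
  unfold path; split_ifs <;> simp

theorem card_beads (μ : PartitionSeq) (N : ℕ) : (μ.beads N).card = N := by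
  rw [beads, Finset.card_image_of_injective, Finset.card_range]
  intro a b h
  have h' : (μ.part a : ℤ) - a = μ.part b - b := h
  rcases le_total a b with hab | hab
  · have := μ.antitone' hab
    omega
  · have := μ.antitone' hab
    omega

theorem neg_lt_of_mem_beads {μ : PartitionSeq} {N : ℕ} {i : ℤ} (hi : i ∈ μ.beads N) :
    -(N : ℤ) < i := by
  simp only [beads, Finset.mem_image, Finset.mem_range] at hi
  obtain ⟨j, hj, rfl⟩ := hi
  omega

theorem path_eq_zero_iff_le_or_mem_beads {μ : PartitionSeq} {N : ℕ}
    (hN : ∀ j, N ≤ j → μ.part j = 0) (i : ℤ) :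
    μ.path i = 0 ↔ i ≤ -(N : ℤ) ∨ i ∈ μ.beads N := by
  simp only [path_eq_zero_iff, beads, Finset.mem_image, Finset.mem_range]
  constructor
  · rintro ⟨j, rfl⟩
    rcases lt_or_ge j N with hj | hj
    · exact Or.inr ⟨j, hj, rfl⟩
    · left
      rw [hN j hj]
      omega
  · rintro (hi | ⟨j, -, rfl⟩)
    · refine ⟨(-i).toNat, ?_⟩
      rw [hN _ (by omega)]
      omega
    · exact ⟨j, rfl⟩

end PartitionSeq

theorem countL_add_countM_add_countR (f : ℕ) {P : ℤ → Prop} {s : Finset ℤ}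
    (hP : ∀ i, P i ↔ i ∈ s) : countL P + countM f P + countR f P = s.card := by
  classical
  have hL : countL P = (s.filter fun i => i ≤ 0).card := by
    rw [countL, ← Set.ncard_coe_finset]
    congr 1; ext i; simp [hP, and_comm]
  have hM : countM f P = (s.filter fun i => 1 ≤ i ∧ i ≤ (f : ℤ)).card := by
    rw [countM, ← Set.ncard_coe_finset]
    congr 1; ext i; simp only [hP, Set.mem_ofPred_eq, Finset.coe_filter]; tauto
  have hR : countR f P = (s.filter fun i => (f : ℤ) < i).card := by
    rw [countR, ← Set.ncard_coe_finset]
    congr 1; ext i; simp [hP, and_comm]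
  rw [hL, hM, hR, ← Finset.card_union_of_disjoint, ← Finset.card_union_of_disjoint]
  · congr 1; ext i
    simp only [Finset.mem_union, Finset.mem_filter]
    constructor
    · tauto
    · intro hi
      have : i ≤ 0 ∨ (1 ≤ i ∧ i ≤ (f : ℤ)) ∨ (f : ℤ) < i := by omega
      tauto
  · rw [Finset.disjoint_left]
    intro i
    simp only [Finset.mem_union, Finset.mem_filter]
    omega
  · rw [Finset.disjoint_left]
    intro i
    simp only [Finset.mem_filter]
    omega

theorem path_counts_b_eq_f_add_a
    (f n : ℕ) (hn : n ≤ 2 * f + 3) (μ₁ μ₂ : PartitionSeq)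
    (hsize : μ₁.size + μ₂.size = n) :
    countL (pairB μ₁ μ₂ f) + countM f (pairB μ₁ μ₂ f) + countR f (pairB μ₁ μ₂ f) =
      f + (countL (pairA μ₁ μ₂ f) + countM f (pairA μ₁ μ₂ f) + countR f (pairA μ₁ μ₂ f)) := by
  obtain ⟨N₁, h₁⟩ := μ₁.eventually_zero
  obtain ⟨N₂, h₂⟩ := μ₂.eventually_zero
  set N := max N₁ N₂
  set s := μ₁.beads N
  set t := (μ₂.beads (N + f)).image (· + (f : ℤ)) with ht
  have hs0 (i : ℤ) : μ₁.path i = 0 ↔ i ≤ -(N : ℤ) ∨ i ∈ s :=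
    PartitionSeq.path_eq_zero_iff_le_or_mem_beads (fun j hj => h₁ j (by omega)) i
  have hmem (i : ℤ) : i ∈ t ↔ i - f ∈ μ₂.beads (N + f) := by
    simp [ht, sub_eq_add_neg]
  have ht0 (i : ℤ) : μ₂.path (i - f) = 0 ↔ i ≤ -(N : ℤ) ∨ i ∈ t := by
    rw [PartitionSeq.path_eq_zero_iff_le_or_mem_beads (N := N + f)
      (fun j hj => h₂ j (by omega)), hmem]
    apply or_congr_left
    push_cast
    constructor <;> intro h <;> linarith
  have hsN (i : ℤ) (hi : i ∈ s) : ¬ i ≤ -(N : ℤ) :=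
    not_le.mpr (PartitionSeq.neg_lt_of_mem_beads hi)
  have htN (i : ℤ) (hi : i ∈ t) : ¬ i ≤ -(N : ℤ) := by
    have := PartitionSeq.neg_lt_of_mem_beads ((hmem i).mp hi)
    push_cast at this
    linarith
  have hA (i : ℤ) : pairA μ₁ μ₂ f i ↔ i ∈ s \ t := by
    rw [pairA, PartitionSeq.path_eq_one_iff, hs0, ht0, Finset.mem_sdiff]
    have := hsN i
    tauto
  have hB (i : ℤ) : pairB μ₁ μ₂ f i ↔ i ∈ t \ s := by
    rw [pairB, PartitionSeq.path_eq_one_iff, hs0, ht0, Finset.mem_sdiff]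
    have := htN i
    tauto
  rw [countL_add_countM_add_countR f hA, countL_add_countM_add_countR f hB]
  have hsc : s.card = N := PartitionSeq.card_beads μ₁ N
  have htc : t.card = N + f := by
    rw [ht, Finset.card_image_of_injective _ (add_left_injective _), PartitionSeq.card_beads]
  have hst := Finset.card_sdiff_add_card s t
  have hts := Finset.card_sdiff_add_card t s
  rw [Finset.union_comm] at hts
  omega
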